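/- arXiv:1701.08639 — 3 statements merged into one kernel-verified Lean document; each statement's English description precedes it below -/
import Mathlib

section
/- Let d ≥ 3 be an integer and β > atanh(1/(d−1)). Then the function t ↦ log((1−t)/t) − d·log f(β,1−t) has exactly one zero t₊ in the interval (1/2,1), and lim_{B↓0} ∂_B ψ(β,B) = 2t₊ − 1 > 0. -/
open Filter MeasureTheory

/-- `f(β,t) = (c(1−2t) + √(1+(c²−1)(1−2t)²))/(2(1−t))` with `c = exp(−2β)`. -/
noncomputable def fIsing (β t : ℝ) : ℝ :=
  (Real.exp (-2*β) * (1 - 2*t) +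
    Real.sqrt (1 + (Real.exp (-2*β)^2 - 1) * (1 - 2*t)^2)) / (2*(1-t))

/-- `F(β,t) = ∫₀^{min(t,1−t)} log f(β,s) ds`. -/
noncomputable def FIsing (β t : ℝ) : ℝ :=
  ∫ s in (0:ℝ)..(min t (1-t)), Real.log (fIsing β s)

/-- Auxiliary recursion for `g(β,·,m)` on `0 ≤ k ≤ ⌊m/2⌋`. -/
noncomputable def gAux (β : ℝ) (m : ℕ) : ℕ → ℝ
  | 0 => 1
  | 1 => Real.exp (-2*β)
  | (k+2) => (((m:ℝ) - 2*((k:ℝ)+2) + 2) * Real.exp (-2*β) / ((m:ℝ) - ((k:ℝ)+2) + 1)) *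
        gAux β m (k+1)
      + (((k:ℝ)+1) / ((m:ℝ) - ((k:ℝ)+2) + 1)) * gAux β m k

/-- `g(β,k,m) = E[exp(−2β X(k,m))]`, given by the recursion together with the
symmetry `g(β,k,m) = g(β,m−k,m)`. -/
noncomputable def gIsing (β : ℝ) (k m : ℕ) : ℝ :=
  if k ≤ m/2 then gAux β m k else gAux β m (m - k)

/-- `I(t) = (t−1)log(1−t) − t log t` (with `I(0)=I(1)=0` via `Real.log 0 = 0`). -/
noncomputable def IIsing (t : ℝ) : ℝ := (t-1) * Real.log (1-t) - t * Real.log t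

/-- `H(t) = I(t) + d F(β,t)`. -/
noncomputable def HIsing (β : ℝ) (d : ℕ) (t : ℝ) : ℝ := IIsing t + d * FIsing β t

/-- `L(t) = H(t) + 2Bt`. -/
noncomputable def LIsing (β B : ℝ) (d : ℕ) (t : ℝ) : ℝ := HIsing β d t + 2*B*t

/-- The annealed pressure `ψ(β,B) = βd/2 − B + max_{0≤t≤1} L(t)`. -/
noncomputable def psiIsing (β B : ℝ) (d : ℕ) : ℝ :=
  β*(d:ℝ)/2 - B + sSup ((LIsing β B d) '' Set.Icc (0:ℝ) 1)

/-- The (unnormalized) annealed weight of having `j` plus spins: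
`x_j = C(n,j) e^{2Bj} g(β,dj,dn)`. -/
noncomputable def xw (β B : ℝ) (d n j : ℕ) : ℝ :=
  (n.choose j : ℝ) * Real.exp (2*B*(j:ℝ)) * gIsing β (d*j) (d*n)

/-- The inverse hyperbolic tangent: `artanh x = (1/2) log((1+x)/(1−x))`. -/
noncomputable def artanh (x : ℝ) : ℝ := (1/2) * Real.log ((1+x)/(1-x))

/-- The derivative of `H` on `(1/2,1)`. -/
noncomputable def GG (β : ℝ) (d : ℕ) (t : ℝ) : ℝ :=
  Real.log ((1-t)/t) - (d:ℝ) * Real.log (fIsing β (1-t))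

/-- The square root occurring in `f`. -/
noncomputable def ww (c t : ℝ) : ℝ := Real.sqrt (1 + (c^2 - 1) * (2*t-1)^2)

lemma ww_arg_pos {c t : ℝ} (hc : 0 < c) (hc1 : c < 1) (ht : t ∈ Set.Icc (1/2:ℝ) 1) :
    0 < 1 + (c^2 - 1) * (2*t-1)^2 := by
  obtain ⟨h1, h2⟩ := ht
  have hu : (2*t-1)^2 ≤ 1 := by nlinarith
  nlinarith [mul_pos hc hc, mul_nonneg (by nlinarith : (0:ℝ) ≤ 1 - c^2) (sub_nonneg.2 hu)]

lemma ww_pos {c t : ℝ} (hc : 0 < c) (hc1 : c < 1) (ht : t ∈ Set.Icc (1/2:ℝ) 1) :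
    0 < ww c t := Real.sqrt_pos.2 (ww_arg_pos hc hc1 ht)

lemma ww_sq {c t : ℝ} (hc : 0 < c) (hc1 : c < 1) (ht : t ∈ Set.Icc (1/2:ℝ) 1) :
    ww c t ^ 2 = 1 + (c^2 - 1) * (2*t-1)^2 := Real.sq_sqrt (ww_arg_pos hc hc1 ht).le

lemma f_eq (β t : ℝ) : fIsing β (1-t) =
    (Real.exp (-2*β) * (2*t-1) + ww (Real.exp (-2*β)) t) / (2*t) := by
  unfold fIsing ww
  have e1 : 1 - 2*(1-t) = 2*t-1 := by ring
  have e2 : 2*(1-(1-t)) = 2*t := by ring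
  rw [e1, e2]

lemma num_pos {c t : ℝ} (hc : 0 < c) (hc1 : c < 1) (ht : t ∈ Set.Icc (1/2:ℝ) 1) :
    0 < c * (2*t-1) + ww c t := by
  have := ww_pos hc hc1 ht
  have := mul_nonneg hc.le (by linarith [ht.1] : 0 ≤ 2*t-1)
  linarith

lemma f_pos {β t : ℝ} (hc1 : Real.exp (-2*β) < 1) (ht : t ∈ Set.Icc (1/2:ℝ) 1) :
    0 < fIsing β (1-t) := by
  rw [f_eq]
  exact div_pos (num_pos (Real.exp_pos _) hc1 ht) (by linarith [ht.1])

lemma logf_cont {β : ℝ} (hc1 : Real.exp (-2*β) < 1) :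
    ContinuousOn (fun t => Real.log (fIsing β (1-t))) (Set.Icc (1/2:ℝ) 1) := by
  apply ContinuousOn.log _ (fun t ht => (f_pos hc1 ht).ne')
  simp_rw [f_eq]
  unfold ww
  apply ContinuousOn.div (by fun_prop) (by fun_prop)
  intro t ht; linarith [ht.1]

lemma logf_cont2 {β : ℝ} (hc1 : Real.exp (-2*β) < 1) :
    ContinuousOn (fun t => Real.log (fIsing β t)) (Set.Icc (0:ℝ) (1/2)) := by
  have := (logf_cont hc1).comp (f := fun t => 1 - t) (s := Set.Icc (0:ℝ) (1/2)) (by fun_prop)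
    (fun t ht => ⟨by linarith [ht.2], by linarith [ht.1]⟩)
  simpa [Function.comp_def] using this

lemma GG_deriv {β : ℝ} {d : ℕ} (hc1 : Real.exp (-2*β) < 1) {t : ℝ} (ht : t ∈ Set.Ioo (1/2:ℝ) 1) :
    HasDerivAt (GG β d)
      (((d:ℝ) - 2 - d * Real.exp (-2*β) / ww (Real.exp (-2*β)) t) / (2*t*(1-t))) t := by
  have hc := Real.exp_pos (-2*β)
  set c := Real.exp (-2*β) with hcdef
  have ht' : t ∈ Set.Icc (1/2:ℝ) 1 := ⟨ht.1.le, ht.2.le⟩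
  have hw := ww_pos hc hc1 ht'
  have hn := num_pos hc hc1 ht'
  have hsq := ww_sq hc hc1 ht'
  have h0 : 0 < t := by linarith [ht.1]
  have h1 : 0 < 1 - t := by linarith [ht.2]
  have du : HasDerivAt (fun t : ℝ => 2*t-1) 2 t := by
    simpa using ((hasDerivAt_id t).const_mul 2).sub_const 1
  have dw : HasDerivAt (ww c) (((c^2-1) * (2*(2*t-1)*2)) / (2 * ww c t)) t := by
    have h := (((du.pow 2).const_mul (c^2-1)).const_add 1).sqrt (ww_arg_pos hc hc1 ht').ne'
    convert h using 1
    · rfl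
    · simp [ww]
  have dn : HasDerivAt (fun t => c*(2*t-1) + ww c t)
      (c*2 + ((c^2-1) * (2*(2*t-1)*2)) / (2 * ww c t)) t := (du.const_mul c).add dw
  have dlt : HasDerivAt (fun t : ℝ => 2*t) 2 t := by
    simpa using (hasDerivAt_id t).const_mul 2
  have dlm : HasDerivAt (fun t : ℝ => 1-t) (-1) t := by
    simpa using (hasDerivAt_id t).const_sub 1
  have D := ((dlm.log h1.ne').sub ((hasDerivAt_id t).log h0.ne')).sub
    (((dn.log hn.ne').sub (dlt.log (by positivity))).const_mul (d:ℝ))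
  refine (D.congr_deriv ?_).congr_of_eventuallyEq ?_
  · have key : (c*2 + ((c^2-1) * (2*(2*t-1)*2)) / (2 * ww c t)) / (c*(2*t-1) + ww c t)
        = (c / ww c t - (2*t-1)) / (2*t*(1-t)) := by
      rw [div_eq_div_iff hn.ne' (by positivity)]
      field_simp
      generalize ww c t = w at *
      linear_combination (2*t-1) * hsq
    rw [key]
    simp only [id]
    field_simp
    ring
  · filter_upwards [Ioo_mem_nhds ht.1 ht.2] with x hx
    have hx' : x ∈ Set.Icc (1/2:ℝ) 1 := ⟨hx.1.le, hx.2.le⟩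
    have hx0 : x ≠ 0 := by linarith [hx.1]
    have hx1 : 1 - x ≠ 0 := by linarith [hx.2]
    simp only [GG, f_eq, Pi.sub_apply, id]
    rw [Real.log_div hx1 hx0, Real.log_div (num_pos hc hc1 hx').ne' (by simpa using hx0)]

lemma GG_cont {β : ℝ} {d : ℕ} (hc1 : Real.exp (-2*β) < 1) :
    ContinuousOn (GG β d) (Set.Ico (1/2:ℝ) 1) := by
  unfold GG
  apply ContinuousOn.sub
  · apply ContinuousOn.log
    · exact ContinuousOn.div (by fun_prop) (by fun_prop) (fun t ht => by linarith [ht.1])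
    · intro t ht
      exact (div_pos (by linarith [ht.2]) (by linarith [ht.1])).ne'
  · exact ((logf_cont hc1).mono Set.Ico_subset_Icc_self).const_smul (d:ℝ)

lemma GG_half (β : ℝ) (d : ℕ) : GG β d (1/2) = 0 := by
  unfold GG
  rw [f_eq]
  norm_num [ww]

lemma GG_neg {β : ℝ} (d : ℕ) (hc1 : Real.exp (-2*β) < 1) (K a : ℝ) (ha : a < 1) :
    ∃ t ∈ Set.Ioo a 1, GG β d t < K := by
  have h1 : Tendsto (fun t : ℝ => Real.log ((1-t)/t)) (nhdsWithin 1 (Set.Iio 1)) atBot := by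
    apply Real.tendsto_log_nhdsGT_zero.comp
    apply tendsto_nhdsWithin_iff.2
    constructor
    · have : ContinuousAt (fun t : ℝ => (1-t)/t) 1 :=
        ContinuousAt.div (by fun_prop) (by fun_prop) (by norm_num)
      have := this.tendsto
      simp only [sub_self, zero_div] at this
      exact this.mono_left nhdsWithin_le_nhds
    · filter_upwards [Ioo_mem_nhdsLT (show (0:ℝ) < 1 by norm_num)] with t ht
      exact div_pos (by linarith [ht.2]) ht.1
  have h2 : Tendsto (fun t : ℝ => -((d:ℝ) * Real.log (fIsing β (1-t))))
      (nhdsWithin 1 (Set.Iio 1)) (nhds (-((d:ℝ) * Real.log (fIsing β (1-1))))) := by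
    have := ((logf_cont hc1) 1 ⟨by norm_num, le_refl _⟩).tendsto
    have h3 := this.mono_left (nhdsWithin_mono (s := Set.Ioo (1/2:ℝ) 1) _ Set.Ioo_subset_Icc_self)
    rw [nhdsWithin_Ioo_eq_nhdsLT (by norm_num)] at h3
    exact (h3.const_mul _).neg
  have h3 := h1.atBot_add h2
  obtain ⟨t, ht, ht2⟩ := ((h3.eventually_lt_atBot K).and (Ioo_mem_nhdsLT ha)).exists
  exact ⟨t, ht2, by unfold GG; linarith⟩

lemma GG_shape {β : ℝ} {d : ℕ} (hd : 3 ≤ d) (hc : Real.exp (-2*β) < ((d:ℝ)-2)/d) :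
    ∃ ts ∈ Set.Ioo (1/2:ℝ) 1, StrictMonoOn (GG β d) (Set.Icc (1/2) ts) ∧
      StrictAntiOn (GG β d) (Set.Ico ts 1) := by
  have hd' : (3:ℝ) ≤ d := by exact_mod_cast hd
  have hc0 := Real.exp_pos (-2*β)
  have hc1 : Real.exp (-2*β) < 1 := hc.trans (by rw [div_lt_one (by linarith)]; linarith)
  set c := Real.exp (-2*β) with hcdef
  have hcd : d * c < d - 2 := by rw [lt_div_iff₀ (by linarith)] at hc; linarith
  set r := d * c / (d - 2) with hr
  have hr1 : r < 1 := by rw [hr, div_lt_one (by linarith)]; exact hcd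
  have hrc : c < r := by rw [hr, lt_div_iff₀ (by linarith)]; nlinarith
  have hcc : 0 < 1 - c^2 := by nlinarith
  set v := (1 - r^2)/(1-c^2) with hv
  have hv0 : 0 < v := div_pos (by nlinarith) hcc
  have hv1 : v < 1 := by rw [hv, div_lt_one hcc]; nlinarith
  have hvs : v * (1-c^2) = 1 - r^2 := by rw [hv]; field_simp
  have hs0 : 0 < Real.sqrt v := Real.sqrt_pos.2 hv0
  have hs1 : Real.sqrt v < 1 := by rw [Real.sqrt_lt' one_pos]; simpa using hv1
  have hss : Real.sqrt v ^2 = v := Real.sq_sqrt hv0.le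
  have hcont := GG_cont (d := d) hc1
  refine ⟨(1 + Real.sqrt v)/2, ⟨by linarith, by linarith⟩, ?_, ?_⟩
  · apply strictMonoOn_of_deriv_pos (convex_Icc _ _)
    · exact hcont.mono (fun t ht => ⟨ht.1, by linarith [ht.2]⟩)
    · intro t ht
      rw [interior_Icc] at ht
      have ht1 : t < 1 := by linarith [ht.2]
      have ht0 := ht.1
      have ht2 := ht.2
      have ht' : t ∈ Set.Icc (1/2:ℝ) 1 := ⟨ht.1.le, ht1.le⟩
      rw [(GG_deriv hc1 ⟨ht.1, ht1⟩).deriv]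
      have hw := ww_pos hc0 hc1 ht'
      have hsq := ww_sq hc0 hc1 ht'
      have hu : (2*t-1)^2 < v := by rw [← hss]; nlinarith
      have hwr : r < ww c t := by
        apply lt_of_pow_lt_pow_left₀ 2 hw.le
        nlinarith
      rw [hr, div_lt_iff₀ (by linarith)] at hwr
      apply div_pos
      · rw [sub_pos, div_lt_iff₀ hw]; linarith
      · have : 0 < 1 - t := by linarith
        have : 0 < t := by linarith
        positivity
  · apply strictAntiOn_of_deriv_neg (convex_Ico _ _)
    · exact hcont.mono (fun t ht => ⟨by linarith [ht.1], ht.2⟩)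
    · intro t ht
      rw [interior_Ico] at ht
      have ht1 : t < 1 := ht.2
      have ht2 := ht.1
      have ht0 : 1/2 < t := by linarith [ht.1]
      have ht' : t ∈ Set.Icc (1/2:ℝ) 1 := ⟨ht0.le, ht1.le⟩
      rw [(GG_deriv hc1 ⟨ht0, ht1⟩).deriv]
      have hw := ww_pos hc0 hc1 ht'
      have hsq := ww_sq hc0 hc1 ht'
      have hu : v < (2*t-1)^2 := by rw [← hss]; nlinarith
      have hwr : ww c t < r := by
        apply lt_of_pow_lt_pow_left₀ 2 (by linarith)
        nlinarith
      rw [hr, lt_div_iff₀ (by linarith)] at hwr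
      apply div_neg_of_neg_of_pos
      · rw [sub_neg, lt_div_iff₀ hw]; linarith
      · have : 0 < 1 - t := by linarith
        have : 0 < t := by linarith
        positivity

lemma GG_zero {β : ℝ} {d : ℕ} (hd : 3 ≤ d) (hc : Real.exp (-2*β) < ((d:ℝ)-2)/d) (B : ℝ)
    (hB : 0 ≤ B) : ∃ tb ∈ Set.Ioo (1/2:ℝ) 1, GG β d tb + 2*B = 0 ∧
      (∀ t ∈ Set.Ioo (1/2:ℝ) tb, 0 < GG β d t + 2*B) ∧
      (∀ t ∈ Set.Ioo tb 1, GG β d t + 2*B < 0) := by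
  have hd' : (3:ℝ) ≤ d := by exact_mod_cast hd
  have hc1 : Real.exp (-2*β) < 1 := hc.trans (by rw [div_lt_one (by linarith)]; linarith)
  obtain ⟨ts, hts, hm, ha⟩ := GG_shape hd hc
  obtain ⟨t1, ht1, hn⟩ := GG_neg d hc1 (-2*B) ts hts.2
  have hpos : ∀ t, 1/2 < t → t ≤ ts → 0 < GG β d t := by
    intro t h1 h2
    rw [← GG_half β d]
    exact hm ⟨le_refl _, hts.1.le⟩ ⟨h1.le, h2⟩ h1
  have hp := hpos ts hts.1 le_rfl
  have hcont : ContinuousOn (GG β d) (Set.Icc ts t1) :=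
    (GG_cont hc1).mono (fun t ht => ⟨by linarith [ht.1, hts.1], by linarith [ht.2, ht1.2]⟩)
  obtain ⟨tb, htb, hz⟩ := intermediate_value_Icc' ht1.1.le hcont
    (show -2*B ∈ Set.Icc _ _ from ⟨hn.le, by linarith⟩)
  have htb1 : tb < 1 := lt_of_le_of_lt htb.2 ht1.2
  refine ⟨tb, ⟨by linarith [htb.1, hts.1], htb1⟩, by linarith, ?_, ?_⟩
  · intro t ht
    rcases le_total t ts with h | h
    · linarith [hpos t ht.1 h]
    · have := ha ⟨h, ht.2.trans htb1⟩ ⟨htb.1, htb1⟩ ht.2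
      linarith
  · intro t ht
    have := ha ⟨htb.1, htb1⟩ ⟨by linarith [ht.1, htb.1], ht.2⟩ ht.1
    linarith

lemma H_symm (β : ℝ) (d : ℕ) (t : ℝ) : HIsing β d (1-t) = HIsing β d t := by
  unfold HIsing IIsing FIsing
  have : 1 - (1-t) = t := by ring
  rw [this, min_comm]
  ring

lemma H_eq (β : ℝ) (d : ℕ) {t : ℝ} (ht : 1/2 ≤ t) : HIsing β d t =
    Real.negMulLog (1-t) + Real.negMulLog t +
      d * ∫ s in (0:ℝ)..(1-t), Real.log (fIsing β s) := by
  unfold HIsing IIsing FIsing Real.negMulLog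
  rw [min_eq_right (by linarith)]
  ring

lemma H_cont {β : ℝ} (d : ℕ) (hc1 : Real.exp (-2*β) < 1) :
    ContinuousOn (HIsing β d) (Set.Icc (1/2:ℝ) 1) := by
  have h : ContinuousOn (fun x => ∫ s in (0:ℝ)..x, Real.log (fIsing β s)) (Set.Icc 0 (1/2)) := by
    have := intervalIntegral.continuousOn_primitive_interval (μ := volume) (a := 0) (b := (1/2:ℝ))
      (f := fun s => Real.log (fIsing β s)) (by
        rw [Set.uIcc_of_le (by norm_num)]
        exact (logf_cont2 hc1).integrableOn_Icc)
    rwa [Set.uIcc_of_le (by norm_num)] at this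
  have h2 := h.comp (f := fun t => 1 - t) (s := Set.Icc (1/2:ℝ) 1) (by fun_prop)
    (fun t ht => ⟨by linarith [ht.2], by linarith [ht.1]⟩)
  refine ContinuousOn.congr (f := fun t => Real.negMulLog (1-t) + Real.negMulLog t +
      d * ∫ s in (0:ℝ)..(1-t), Real.log (fIsing β s)) ?_ (fun t ht => H_eq β d ht.1)
  refine ContinuousOn.add ?_ (h2.const_smul (d:ℝ))
  exact ((Real.continuous_negMulLog.comp (by fun_prop)).add
    Real.continuous_negMulLog).continuousOn

lemma H_deriv {β : ℝ} (d : ℕ) (hc1 : Real.exp (-2*β) < 1) {t : ℝ} (ht : t ∈ Set.Ioo (1/2:ℝ) 1) :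
    HasDerivAt (HIsing β d) (GG β d t) t := by
  have h0 : 0 < t := by linarith [ht.1]
  have h1 : 0 < 1 - t := by linarith [ht.2]
  have hs : 1 - t ∈ Set.Ioo (0:ℝ) (1/2) := ⟨h1, by linarith [ht.1]⟩
  have dlm : HasDerivAt (fun t : ℝ => 1-t) (-1) t := by
    simpa using (hasDerivAt_id t).const_sub 1
  have hco := (logf_cont2 hc1).mono (Set.Ioo_subset_Icc_self)
  have hF : HasDerivAt (fun x => ∫ s in (0:ℝ)..x, Real.log (fIsing β s))
      (Real.log (fIsing β (1-t))) (1-t) := by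
    apply intervalIntegral.integral_hasDerivAt_right
    · apply ContinuousOn.intervalIntegrable
      rw [Set.uIcc_of_le h1.le]
      exact (logf_cont2 hc1).mono (Set.Icc_subset_Icc le_rfl hs.2.le)
    · exact hco.stronglyMeasurableAtFilter isOpen_Ioo _ hs
    · exact hco.continuousAt (Ioo_mem_nhds hs.1 hs.2)
  have D := (((Real.hasDerivAt_negMulLog h1.ne').comp t dlm).add
    (Real.hasDerivAt_negMulLog h0.ne')).add ((hF.comp t dlm).const_mul (d:ℝ))
  refine (D.congr_deriv ?_).congr_of_eventuallyEq ?_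
  · unfold GG
    rw [Real.log_div h1.ne' h0.ne']
    ring
  · filter_upwards [Ioo_mem_nhds ht.1 ht.2] with x hx
    exact H_eq β d hx.1.le

lemma L_max {β : ℝ} {d : ℕ} (hc1 : Real.exp (-2*β) < 1) {B tb : ℝ} (hB : 0 ≤ B)
    (htb : tb ∈ Set.Ioo (1/2:ℝ) 1)
    (hp : ∀ t ∈ Set.Ioo (1/2:ℝ) tb, 0 < GG β d t + 2*B)
    (hn : ∀ t ∈ Set.Ioo tb 1, GG β d t + 2*B < 0) :
    ∀ t ∈ Set.Icc (0:ℝ) 1, LIsing β B d t ≤ LIsing β B d tb := by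
  have hcont : ContinuousOn (LIsing β B d) (Set.Icc (1/2:ℝ) 1) := by
    unfold LIsing
    exact (H_cont d hc1).add (by fun_prop)
  have hder : ∀ t ∈ Set.Ioo (1/2:ℝ) 1, HasDerivAt (LIsing β B d) (GG β d t + 2*B) t := by
    intro t ht
    have := (H_deriv d hc1 ht).add ((hasDerivAt_id t).const_mul (2*B))
    rw [mul_one] at this
    exact this
  have hmono : StrictMonoOn (LIsing β B d) (Set.Icc (1/2) tb) := by
    apply strictMonoOn_of_deriv_pos (convex_Icc _ _)
    · exact hcont.mono (Set.Icc_subset_Icc le_rfl htb.2.le)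
    · intro t ht
      rw [interior_Icc] at ht
      rw [(hder t ⟨ht.1, ht.2.trans htb.2⟩).deriv]
      exact hp t ht
  have hanti : StrictAntiOn (LIsing β B d) (Set.Icc tb 1) := by
    apply strictAntiOn_of_deriv_neg (convex_Icc _ _)
    · exact hcont.mono (Set.Icc_subset_Icc htb.1.le le_rfl)
    · intro t ht
      rw [interior_Icc] at ht
      rw [(hder t ⟨htb.1.trans ht.1, ht.2⟩).deriv]
      exact hn t ht
  have hbig : ∀ t ∈ Set.Icc (1/2:ℝ) 1, LIsing β B d t ≤ LIsing β B d tb := by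
    intro t ht
    rcases le_total t tb with h | h
    · exact hmono.monotoneOn ⟨ht.1, h⟩ ⟨htb.1.le, le_rfl⟩ h
    · exact hanti.antitoneOn ⟨le_rfl, htb.2.le⟩ ⟨h, ht.2⟩ h
  intro t ht
  rcases le_total (1/2) t with h | h
  · exact hbig t ⟨h, ht.2⟩
  · refine le_trans ?_ (hbig (1-t) ⟨by linarith, by linarith [ht.1]⟩)
    unfold LIsing
    rw [H_symm]
    nlinarith

lemma c_lt {β : ℝ} {d : ℕ} (hd : 3 ≤ d) (hβ : artanh (1/((d:ℝ)-1)) < β) :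
    Real.exp (-2*β) < ((d:ℝ)-2)/d := by
  have hd' : (3:ℝ) ≤ d := by exact_mod_cast hd
  have h1 : (0:ℝ) < d - 1 := by linarith
  have h2 : (0:ℝ) < d - 2 := by linarith
  have h3 : (0:ℝ) < d := by linarith
  have e : (1 + 1/((d:ℝ)-1))/(1 - 1/((d:ℝ)-1)) = d / (d-2) := by
    have e1 : 1 - 1/((d:ℝ)-1) = (d-2)/(d-1) := by field_simp; ring
    have e2 : 1 + 1/((d:ℝ)-1) = d/(d-1) := by field_simp; ring
    rw [e1, e2]
    field_simp
  unfold artanh at hβ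
  rw [e] at hβ
  rw [← Real.lt_log_iff_exp_lt (by positivity), ← inv_div (d:ℝ), Real.log_inv]
  linarith

/-- in the low-temperature regime `β > atanh(1/(d−1))`, the function
`t ↦ log((1−t)/t) − d log f(β,1−t)` has exactly one zero `t₊ ∈ (1/2,1)`, and the
right limit at `B = 0` of `∂_B ψ(β,B)` equals `2t₊ − 1 > 0`. -/
theorem annealed_spontaneous_magnetization (β : ℝ) (d : ℕ) (hd : 3 ≤ d)
    (hβ : artanh (1/((d:ℝ)-1)) < β) :
    ∃ tp : ℝ, tp ∈ Set.Ioo (1/2 : ℝ) 1 ∧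
      Real.log ((1-tp)/tp) - (d:ℝ) * Real.log (fIsing β (1-tp)) = 0 ∧
      (∀ t ∈ Set.Ioo (1/2 : ℝ) 1,
        Real.log ((1-t)/t) - (d:ℝ) * Real.log (fIsing β (1-t)) = 0 → t = tp) ∧
      0 < 2*tp - 1 ∧
      Filter.Tendsto (fun B => deriv (fun B' => psiIsing β B' d) B)
        (nhdsWithin 0 (Set.Ioi 0)) (nhds (2*tp - 1)) := by
  have hd' : (3:ℝ) ≤ d := by exact_mod_cast hd
  have hc := c_lt hd hβ
  have hc1 : Real.exp (-2*β) < 1 := hc.trans (by rw [div_lt_one (by linarith)]; linarith)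
  choose! T hT hz hp hn using fun B => GG_zero (β := β) hd hc B
  have hmax := fun B (hB : 0 ≤ B) => L_max hc1 hB (hT B hB) (hp B hB) (hn B hB)
  -- continuity of the maximizer
  have hcont : ∀ B, 0 ≤ B → Tendsto T (nhdsWithin B (Set.Ici 0)) (nhds (T B)) := by
    intro B hB
    have haff : ∀ a : ℝ, Tendsto (fun B' : ℝ => a + 2*B') (nhdsWithin B (Set.Ici 0))
        (nhds (a + 2*B)) := fun a =>
      (Continuous.tendsto (by fun_prop) B).mono_left nhdsWithin_le_nhds
    apply tendsto_order.2
    constructor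
    · intro a ha
      obtain ⟨a', h1, h2⟩ := exists_between (max_lt ha (hT B hB).1)
      have h3 : 1/2 < a' := lt_of_le_of_lt (le_max_right _ _) h1
      have h4 : a < a' := lt_of_le_of_lt (le_max_left _ _) h1
      filter_upwards [(haff _).eventually_const_lt (hp B hB a' ⟨h3, h2⟩), self_mem_nhdsWithin]
        with B' hB' hB0
      by_contra! hcon
      rcases (hcon.trans_lt h4) with h5
      have := hn B' hB0 a' ⟨h5, h2.trans (hT B hB).2⟩
      linarith
    · intro a ha
      obtain ⟨a', h1, h2⟩ := exists_between (lt_min ha (hT B hB).2)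
      have h3 : a' < 1 := h2.trans_le (min_le_right _ _)
      have h4 : a' < a := h2.trans_le (min_le_left _ _)
      filter_upwards [(haff _).eventually_lt_const (hn B hB a' ⟨h1, h3⟩), self_mem_nhdsWithin]
        with B' hB' hB0
      by_contra! hcon
      have := hp B' hB0 a' ⟨(hT B hB).1.trans h1, h4.trans_le hcon⟩
      linarith
  have hTI : ∀ B, 0 ≤ B → T B ∈ Set.Icc (0:ℝ) 1 := fun B hB =>
    ⟨by linarith [(hT B hB).1], (hT B hB).2.le⟩
  have hpsi : ∀ B, 0 ≤ B → psiIsing β B d = β*(d:ℝ)/2 - B + LIsing β B d (T B) := by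
    intro B hB
    unfold psiIsing
    congr 1
    apply IsGreatest.csSup_eq
    refine ⟨⟨T B, hTI B hB, rfl⟩, ?_⟩
    rintro _ ⟨t, ht, rfl⟩
    exact hmax B hB t ht
  have hder : ∀ B, 0 < B → HasDerivAt (fun B' => psiIsing β B' d) (2 * T B - 1) B := by
    intro B hB
    rw [hasDerivAt_iff_isLittleO, Asymptotics.isLittleO_iff]
    intro ε hε
    have hT' : Tendsto T (nhds B) (nhds (T B)) := by
      have := hcont B hB.le
      rwa [nhdsWithin_eq_nhds.2 (Ici_mem_nhds hB)] at this
    filter_upwards [Metric.tendsto_nhds.1 hT' (ε/2) (by positivity), Ioi_mem_nhds hB]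
      with B' hB' hB0
    have hB0 : 0 < B' := hB0
    rw [hpsi B hB.le, hpsi B' hB0.le]
    have e1 := hmax B' hB0.le (T B) (hTI B hB.le)
    have e2 := hmax B hB.le (T B') (hTI B' hB0.le)
    unfold LIsing at *
    rw [Real.dist_eq] at hB'
    simp only [Real.norm_eq_abs, smul_eq_mul]
    set x := HIsing β d (T B)
    set y := HIsing β d (T B')
    have k1 : 0 ≤ β*(d:ℝ)/2 - B' + (y + 2*B'*T B') - (β*(d:ℝ)/2 - B + (x + 2*B*T B))
        - (B' - B) * (2 * T B - 1) := by linarith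
    have k2 : β*(d:ℝ)/2 - B' + (y + 2*B'*T B') - (β*(d:ℝ)/2 - B + (x + 2*B*T B))
        - (B' - B) * (2 * T B - 1) ≤ 2 * ((T B' - T B) * (B' - B)) := by linarith
    rw [abs_of_nonneg k1]
    refine k2.trans ?_
    have k3 := le_abs_self ((T B' - T B) * (B' - B))
    rw [abs_mul] at k3
    nlinarith [abs_nonneg (B' - B)]
  have hz0 := hz 0 le_rfl
  refine ⟨T 0, hT 0 le_rfl, ?_, ?_, ?_, ?_⟩
  · simpa [GG] using hz0
  · intro t ht h
    have h' : GG β d t = 0 := h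
    rcases lt_trichotomy t (T 0) with h1 | h1 | h1
    · have := hp 0 le_rfl t ⟨ht.1, h1⟩
      linarith
    · exact h1
    · have := hn 0 le_rfl t ⟨h1, ht.2⟩
      linarith
  · linarith [(hT 0 le_rfl).1]
  · have h1 : Tendsto (fun B => 2 * T B - 1) (nhdsWithin 0 (Set.Ioi 0)) (nhds (2 * T 0 - 1)) :=
      (((hcont 0 le_rfl).mono_left (nhdsWithin_mono _ Set.Ioi_subset_Ici_self)).const_mul 2).sub_const 1
    refine h1.congr' ?_
    filter_upwards [self_mem_nhdsWithin] with B hB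
    exact (hder B hB).deriv.symm
end

section
/- Let d ≥ 3 be an integer and 0 < β < atanh(1/(d−1)). Then the function H(t) = I(t) + d·F(β,t) is twice differentiable on (0,1) with H''(t) < 0 for all t ∈ (0,1); consequently H′ is strictly decreasing on (0,1) and t = 1/2 is its unique zero. Moreover, the function B ↦ ψ(β,B) is differentiable at B = 0 with derivative 0, and lim_{B↓0} ∂_B ψ(β,B) = 0. -/
open Filter MeasureTheory

theorem aux_R_pos {c t : ℝ} (hc : 0 < c) (ht : t ∈ Set.Ico (0:ℝ) 1) :
    0 < 1 + (c^2 - 1) * (1 - 2*t)^2 := by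
  obtain ⟨h0, h1⟩ := ht
  have h2 : 0 ≤ t * (1 - t) := mul_nonneg h0 (by linarith)
  rcases eq_or_lt_of_le h0 with h | h
  · rw [← h]; nlinarith [sq_nonneg c, pow_pos hc 2]
  · have : 0 < t * (1 - t) := mul_pos h (by linarith)
    nlinarith [mul_nonneg (sq_nonneg c) (sq_nonneg (1 - 2*t))]

theorem aux_N_pos {c t : ℝ} (hc : 0 < c) (ht : t ∈ Set.Ico (0:ℝ) 1) :
    0 < c * (1 - 2*t) + Real.sqrt (1 + (c^2 - 1) * (1 - 2*t)^2) := by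
  have hR := aux_R_pos hc ht
  have hs := Real.sqrt_pos.2 hR
  obtain ⟨h0, h1⟩ := ht
  rcases le_or_gt t (1/2) with h | h
  · have : 0 ≤ c * (1 - 2*t) := mul_nonneg hc.le (by linarith)
    linarith
  · have : c * (2*t - 1) < Real.sqrt (1 + (c^2 - 1) * (1 - 2*t)^2) := by
      apply Real.lt_sqrt_of_sq_lt
      have : 0 < t * (1 - t) := mul_pos (by linarith) (by linarith)
      nlinarith
    linarith

theorem aux_f_pos {β t : ℝ} (ht : t ∈ Set.Ico (0:ℝ) 1) : 0 < fIsing β t := by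
  unfold fIsing
  exact div_pos (aux_N_pos (Real.exp_pos _) ht) (by linarith [ht.2])

theorem aux_f_contOn (β : ℝ) : ContinuousOn (fun s => Real.log (fIsing β s)) (Set.Ico 0 1) := by
  apply ContinuousOn.log
  · unfold fIsing
    apply ContinuousOn.div
    · fun_prop
    · fun_prop
    · intro x hx; have := hx.2; intro h; linarith
  · intro x hx; exact (aux_f_pos hx).ne'

theorem aux_f_symm {β t : ℝ} (ht : t ∈ Set.Ioo (0:ℝ) 1) :
    Real.log (fIsing β (1 - t)) = - Real.log (fIsing β t) := by
  rw [← Real.log_inv]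
  congr 1
  have h1 : (1 - t) ∈ Set.Ioo (0:ℝ) 1 := ⟨by linarith [ht.2], by linarith [ht.1]⟩
  have hf := aux_f_pos (β := β) (Set.Ioo_subset_Ico_self ht)
  have hR := aux_R_pos (Real.exp_pos (-2*β)) (Set.Ioo_subset_Ico_self ht)
  apply eq_inv_of_mul_eq_one_left
  unfold fIsing
  set c := Real.exp (-2*β)
  have e : (1 - 2*(1-t))^2 = (1-2*t)^2 := by ring
  rw [e]
  set R := Real.sqrt (1 + (c^2 - 1) * (1 - 2*t)^2) with hRd
  have hsq : R^2 = 1 + (c^2 - 1) * (1 - 2*t)^2 := Real.sq_sqrt hR.le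
  have a1 : (1 - t) ≠ 0 := by linarith [h1.1]
  have a2 : t ≠ 0 := ht.1.ne'
  have a3 : 1 - (1 - t) ≠ 0 := by simpa using a2
  rw [div_mul_div_comm, div_eq_one_iff_eq (by positivity)]
  linear_combination hsq

theorem aux_logf_deriv {β t : ℝ} (ht : t ∈ Set.Ioo (0:ℝ) 1) :
    HasDerivAt (fun s => Real.log (fIsing β s))
      ((1 - Real.exp (-2*β) / Real.sqrt (1 + (Real.exp (-2*β)^2 - 1) * (1 - 2*t)^2)) /
        (2 * (t * (1 - t)))) t := by
  have htI := Set.Ioo_subset_Ico_self ht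
  have hf := aux_f_pos (β := β) htI
  have hR := aux_R_pos (Real.exp_pos (-2*β)) htI
  have hN := aux_N_pos (Real.exp_pos (-2*β)) htI
  have hs := Real.sqrt_pos.2 hR
  have h1t : 0 < 1 - t := by linarith [ht.2]
  have h0t : 0 < t := ht.1
  unfold fIsing at hf ⊢
  set c := Real.exp (-2*β)
  have d1 : HasDerivAt (fun s : ℝ => 1 - 2*s) (-2) t := by
    simpa using ((hasDerivAt_id t).const_mul 2).const_sub 1
  have d2 : HasDerivAt (fun s : ℝ => 1 + (c^2 - 1) * (1 - 2*s)^2)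
      ((c^2-1) * (2 * (1-2*t) * (-2))) t := by
    simpa using ((d1.pow 2).const_mul (c^2-1)).const_add 1
  have d3 := (d1.const_mul c).add (d2.sqrt hR.ne')
  have d4 : HasDerivAt (fun s : ℝ => 2*(1-s)) (-2) t := by
    simpa using ((hasDerivAt_id t).const_sub 1).const_mul 2
  have d5 := (d3.div d4 (by positivity)).log (by exact hf.ne')
  refine d5.congr_deriv ?_
  simp only [Pi.add_apply, Pi.div_apply]
  set R := Real.sqrt (1 + (c^2 - 1) * (1 - 2*t)^2) with hRd
  have hsq : R^2 = 1 + (c^2 - 1) * (1 - 2*t)^2 := Real.sq_sqrt hR.le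
  have key : (c * (-2) + (c^2-1) * (2 * (1-2*t) * (-2)) / (2*R)) * (2 * (t * (1-t))) * R
      = ((1 - 2*t) * R - c) * (c * (1-2*t) + R) := by
    field_simp
    linear_combination (-(1 - 2*t)) * hsq
  have hN0 := hN.ne'
  have e1 : (c * (-2) + (c^2-1) * (2 * (1-2*t) * (-2)) / (2*R)) 
      = ((1 - 2*t) * R - c) * (c * (1-2*t) + R) / ((2 * (t * (1-t))) * R) := by
    rw [eq_div_iff (by positivity), ← key]; ring
  rw [e1]
  clear e1 key
  generalize c * (1-2*t) + R = N at hN0 ⊢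
  field_simp
  ring

theorem aux_P_deriv {β t : ℝ} (ht : t ∈ Set.Ioo (0:ℝ) 1) :
    HasDerivAt (fun x => ∫ s in (0:ℝ)..x, Real.log (fIsing β s)) (Real.log (fIsing β t)) t := by
  apply intervalIntegral.integral_hasDerivAt_right
  · apply ContinuousOn.intervalIntegrable
    rw [Set.uIcc_of_le ht.1.le]
    exact (aux_f_contOn β).mono (Set.Icc_subset_Ico_right ht.2)
  · exact ((aux_f_contOn β).mono Set.Ioo_subset_Ico_self).stronglyMeasurableAtFilter
      isOpen_Ioo t ht
  · exact ((aux_f_contOn β).mono Set.Ioo_subset_Ico_self).continuousAt (Ioo_mem_nhds ht.1 ht.2)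

theorem aux_F_eq {β t : ℝ} (ht : t ∈ Set.Ioo (0:ℝ) 1) :
    FIsing β t = ∫ s in (0:ℝ)..t, Real.log (fIsing β s) := by
  unfold FIsing
  rcases le_or_gt t (1/2) with h | h
  · rw [min_eq_left (by linarith)]
  · rw [min_eq_right (by linarith)]
    have h1 : (1 - t) ∈ Set.Ioo (0:ℝ) 1 := ⟨by linarith [ht.2], by linarith [ht.1]⟩
    have hint : ∀ x ∈ Set.Ioo (0:ℝ) 1,
        IntervalIntegrable (fun s => Real.log (fIsing β s)) volume 0 x := by
      intro x hx
      apply ContinuousOn.intervalIntegrable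
      rw [Set.uIcc_of_le hx.1.le]
      exact (aux_f_contOn β).mono (Set.Icc_subset_Ico_right hx.2)
    have hadd := intervalIntegral.integral_add_adjacent_intervals (hint _ h1)
      ((hint _ h1).symm.trans (hint _ ht))
    have hz : ∫ s in (1-t)..t, Real.log (fIsing β s) = 0 := by
      have e1 := intervalIntegral.integral_comp_sub_left (a := 1 - t) (b := t)
        (fun s => Real.log (fIsing β s)) 1
      have e2 : ∫ s in (1-t)..t, Real.log (fIsing β (1 - s))
          = ∫ s in (1-t)..t, - Real.log (fIsing β s) := by
        apply intervalIntegral.integral_congr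
        intro s hs
        rw [Set.uIcc_of_le (by linarith)] at hs
        exact aux_f_symm ⟨by linarith [hs.1, h1.1], by linarith [hs.2, ht.2]⟩
      rw [intervalIntegral.integral_neg] at e2
      rw [sub_sub_cancel] at e1
      linarith
    linarith

theorem aux_F_deriv {β t : ℝ} (ht : t ∈ Set.Ioo (0:ℝ) 1) :
    HasDerivAt (FIsing β) (Real.log (fIsing β t)) t := by
  refine (aux_P_deriv ht).congr_of_eventuallyEq ?_
  filter_upwards [Ioo_mem_nhds ht.1 ht.2] with x hx using aux_F_eq hx

theorem aux_I_deriv {t : ℝ} (ht : t ∈ Set.Ioo (0:ℝ) 1) :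
    HasDerivAt IIsing (Real.log (1 - t) - Real.log t) t := by
  have h1t : 1 - t ≠ 0 := by linarith [ht.2]
  have h0 : t ≠ 0 := ht.1.ne'
  unfold IIsing
  have a1 : HasDerivAt (fun s : ℝ => 1 - s) (-1) t := by
    simpa using (hasDerivAt_id t).const_sub 1
  have a2 : HasDerivAt (fun s : ℝ => s - 1) 1 t := by
    simpa using (hasDerivAt_id t).sub_const 1
  refine ((a2.mul (a1.log h1t)).sub ((hasDerivAt_id t).mul
    ((hasDerivAt_id t).log h0))).congr_deriv ?_
  simp only [id]
  field_simp
  ring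

theorem aux_H_deriv {β : ℝ} {d : ℕ} {t : ℝ} (ht : t ∈ Set.Ioo (0:ℝ) 1) :
    HasDerivAt (HIsing β d) (Real.log (1 - t) - Real.log t + d * Real.log (fIsing β t)) t :=
  (aux_I_deriv ht).add ((aux_F_deriv ht).const_mul _)

theorem aux_H_deriv2 {β : ℝ} {d : ℕ} {t : ℝ} (ht : t ∈ Set.Ioo (0:ℝ) 1) :
    HasDerivAt (deriv (HIsing β d)) (-1 / (t * (1-t)) +
      d * ((1 - Real.exp (-2*β) / Real.sqrt (1 + (Real.exp (-2*β)^2 - 1) * (1 - 2*t)^2)) /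
        (2 * (t * (1 - t))))) t := by
  have h1t : 1 - t ≠ 0 := by linarith [ht.2]
  have h0 : t ≠ 0 := ht.1.ne'
  have a1 : HasDerivAt (fun s : ℝ => 1 - s) (-1) t := by
    simpa using (hasDerivAt_id t).const_sub 1
  have b := ((a1.log h1t).sub ((hasDerivAt_id t).log h0)).add
    ((aux_logf_deriv (β := β) ht).const_mul (d:ℝ))
  refine (b.congr_of_eventuallyEq ?_).congr_deriv ?_
  · filter_upwards [Ioo_mem_nhds ht.1 ht.2] with x hx
    exact aux_H_deriv hx |>.deriv
  · congr 1
    simp only [id]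
    field_simp
    ring

theorem aux_c_bound {β : ℝ} {d : ℕ} (hd : 3 ≤ d) (hβ : β < artanh (1/((d:ℝ)-1))) :
    d * (1 - Real.exp (-2*β)) < 2 := by
  have hd' : (3:ℝ) ≤ d := by exact_mod_cast hd
  unfold artanh at hβ
  have e : (1 + 1/((d:ℝ)-1)) / (1 - 1/((d:ℝ)-1)) = d / (d - 2) := by
    have : (d:ℝ) - 1 ≠ 0 := by linarith
    have : (d:ℝ) - 2 ≠ 0 := by linarith
    have : 1 - 1/((d:ℝ)-1) = (d - 2)/(d-1) := by field_simp; ring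
    rw [this]
    field_simp
    ring
  rw [e] at hβ
  have h2 : -Real.log (d/((d:ℝ)-2)) < -2*β := by linarith
  rw [← Real.log_inv, inv_div] at h2
  have h3 := (Real.log_lt_iff_lt_exp (div_pos (by linarith) (by linarith))).1 h2
  rw [div_lt_iff₀ (by linarith)] at h3
  linarith

theorem aux_H2_bound {β : ℝ} {d : ℕ} {t : ℝ} (hβ0 : 0 < β)
    (hb : d * (1 - Real.exp (-2*β)) < 2) (ht : t ∈ Set.Ioo (0:ℝ) 1) :
    deriv (deriv (HIsing β d)) t ≤ -2 * (2 - d * (1 - Real.exp (-2*β))) := by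
  rw [(aux_H_deriv2 ht).deriv]
  have htI := Set.Ioo_subset_Ico_self ht
  have hR := aux_R_pos (Real.exp_pos (-2*β)) htI
  have hc := Real.exp_pos (-2*β)
  have hc1 : Real.exp (-2*β) < 1 := by rw [Real.exp_lt_one_iff]; linarith
  set c := Real.exp (-2*β)
  have hs := Real.sqrt_pos.2 hR
  have hR1 : Real.sqrt (1 + (c^2 - 1) * (1 - 2*t)^2) ≤ 1 := by
    rw [Real.sqrt_le_iff]
    refine ⟨zero_le_one, ?_⟩
    have : c^2 ≤ 1 := by nlinarith
    nlinarith [mul_nonneg (sub_nonneg.2 this) (sq_nonneg (1 - 2*t))]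
  set R := Real.sqrt (1 + (c^2 - 1) * (1 - 2*t)^2) with hRd
  have h1 : c ≤ c / R := by rw [le_div_iff₀ hs]; nlinarith
  have hd0 : (0:ℝ) ≤ d := Nat.cast_nonneg d
  have h2 : (d:ℝ) * (1 - c / R) ≤ d * (1 - c) := by gcongr
  have hq : 0 < t * (1 - t) := mul_pos ht.1 (by linarith [ht.2])
  have hq1 : t * (1 - t) ≤ 1/4 := by nlinarith [sq_nonneg (t - 1/2)]
  have e : -1 / (t * (1-t)) + d * ((1 - c / R) / (2 * (t * (1 - t))))
      = (-2 + d * (1 - c/R)) / (2 * (t * (1-t))) := by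
    have : t ≠ 0 := ht.1.ne'
    have : 1 - t ≠ 0 := by linarith [ht.2]
    generalize c / R = x
    field_simp
  rw [e, div_le_iff₀ (by positivity)]
  nlinarith

theorem aux_H_symm (β : ℝ) (d : ℕ) (t : ℝ) : HIsing β d (1 - t) = HIsing β d t := by
  unfold HIsing FIsing IIsing
  rw [sub_sub_cancel, min_comm]
  ring

theorem aux_H_cont (β : ℝ) (d : ℕ) : ContinuousOn (HIsing β d) (Set.Icc 0 (1/2)) := by
  unfold HIsing
  apply ContinuousOn.add
  · have e : IIsing = fun t => -((1-t) * Real.log (1-t)) - t * Real.log t := by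
      funext t; unfold IIsing; ring
    rw [e]
    have h := Real.continuous_mul_log
    have h' : Continuous fun t : ℝ => (1-t) * Real.log (1-t) :=
      h.comp (continuous_const.sub continuous_id)
    exact (h'.neg.sub h).continuousOn
  · apply ContinuousOn.mul continuousOn_const
    have h0 : ContinuousOn (fun s => Real.log (fIsing β s)) (Set.uIcc 0 (1/2)) := by
      rw [Set.uIcc_of_le (by norm_num)]
      exact (aux_f_contOn β).mono (Set.Icc_subset_Ico_right (by norm_num))
    have h1 := intervalIntegral.continuousOn_primitive_interval
      (μ := volume) (h0.integrableOn_compact isCompact_uIcc)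
    rw [Set.uIcc_of_le (by norm_num)] at h1
    refine h1.congr ?_
    intro t ht
    unfold FIsing
    rw [min_eq_left (by linarith [ht.2])]

theorem aux_H_half (β : ℝ) (d : ℕ) : deriv (HIsing β d) (1/2) = 0 := by
  rw [(aux_H_deriv (by norm_num)).deriv]
  have : fIsing β (1/2) = 1 := by unfold fIsing; norm_num
  rw [this]
  norm_num

theorem aux_G_bound {β : ℝ} {d : ℕ} (hβ0 : 0 < β)
    (hb : d * (1 - Real.exp (-2*β)) < 2) {t : ℝ} (ht : t ∈ Set.Icc (0:ℝ) 1) :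
    HIsing β d t ≤ HIsing β d (1/2) - (2 - d * (1 - Real.exp (-2*β))) * (t - 1/2)^2 := by
  set m := 2 - d * (1 - Real.exp (-2*β)) with hm
  -- derivative of the auxiliary function
  have hA : AntitoneOn (fun s => deriv (HIsing β d) s + 2 * m * s) (Set.Ioo 0 1) := by
    have hd : ∀ x ∈ Set.Ioo (0:ℝ) 1, HasDerivAt (fun s => deriv (HIsing β d) s + 2 * m * s)
        (deriv (deriv (HIsing β d)) x + 2 * m) x := by
      intro x hx
      have h2 : HasDerivAt (fun s : ℝ => 2 * m * s) (2*m) x := by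
        simpa using (hasDerivAt_id x).const_mul (2*m)
      exact (aux_H_deriv2 hx).differentiableAt.hasDerivAt.add h2
    apply antitoneOn_of_deriv_nonpos (convex_Ioo 0 1)
    · exact fun x hx => (hd x hx).continuousAt.continuousWithinAt
    · rw [interior_Ioo]
      exact fun x hx => (hd x hx).differentiableAt.differentiableWithinAt
    · rw [interior_Ioo]
      intro x hx
      rw [(hd x hx).deriv]
      have := aux_H2_bound (d := d) hβ0 hb hx
      linarith
  have hM : MonotoneOn (fun s => HIsing β d s + m * (s - 1/2)^2) (Set.Icc 0 (1/2)) := by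
    have hd : ∀ x ∈ Set.Ioo (0:ℝ) (1/2), HasDerivAt (fun s => HIsing β d s + m * (s - 1/2)^2)
        (deriv (HIsing β d) x + m * (2 * (x - 1/2))) x := by
      intro x hx
      have hx' : x ∈ Set.Ioo (0:ℝ) 1 := ⟨hx.1, by linarith [hx.2]⟩
      have h2 : HasDerivAt (fun s : ℝ => m * (s - 1/2)^2) (m * (2 * (x - 1/2))) x := by
        simpa [-one_div] using (((hasDerivAt_id x).sub_const (1/2)).pow 2).const_mul m
      exact (aux_H_deriv hx').differentiableAt.hasDerivAt.add h2
    apply monotoneOn_of_deriv_nonneg (convex_Icc _ _)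
    · exact (aux_H_cont β d).add (by fun_prop)
    · rw [interior_Icc]
      exact fun x hx => (hd x hx).differentiableAt.differentiableWithinAt
    · rw [interior_Icc]
      intro x hx
      rw [(hd x hx).deriv]
      have hx' : x ∈ Set.Ioo (0:ℝ) 1 := ⟨hx.1, by linarith [hx.2]⟩
      have := hA hx' (by norm_num : (1/2:ℝ) ∈ Set.Ioo (0:ℝ) 1) hx.2.le
      simp only [aux_H_half] at this
      linarith
  have key : ∀ s ∈ Set.Icc (0:ℝ) (1/2), HIsing β d s ≤ HIsing β d (1/2) - m * (s - 1/2)^2 := by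
    intro s hs
    have := hM hs (by norm_num : (1/2:ℝ) ∈ Set.Icc (0:ℝ) (1/2)) hs.2
    simp only at this
    linarith
  rcases le_or_gt t (1/2) with h | h
  · exact key t ⟨ht.1, h⟩
  · have := key (1 - t) ⟨by linarith [ht.2], by linarith⟩
    rw [aux_H_symm] at this
    linarith

theorem aux_final (h : ℝ → ℝ) (hz : HasDerivAt h 0 0) (hconv : ConvexOn ℝ Set.univ h)
    (m : ℝ) (hm : 0 < m) (hlo : ∀ B, h 0 ≤ h B) (hhi : ∀ B, h B ≤ h 0 + B^2/m) :
    Filter.Tendsto (fun B => deriv h B) (nhdsWithin 0 (Set.Ioi 0)) (nhds 0) := by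
  have hb : ∀ B : ℝ, 0 < B → 0 ≤ deriv h B ∧ deriv h B ≤ 4 * B / m := by
    intro B hB
    by_cases hd : DifferentiableAt ℝ h B
    · constructor
      · have := hconv.slope_le_deriv (Set.mem_univ 0) (Set.mem_univ B) hB hd
        refine le_trans ?_ this
        rw [slope_def_field]
        exact div_nonneg (by linarith [hlo B]) (by linarith)
      · have := hconv.deriv_le_slope (Set.mem_univ B) (Set.mem_univ (2*B)) (by linarith) hd
        refine this.trans ?_
        rw [slope_def_field, div_le_iff₀ (by linarith)]
        have h1 := hlo B
        have h2 := hhi (2*B)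
        have : 4 * B / m * (2 * B - B) = (2*B)^2/m := by ring
        linarith
    · rw [deriv_zero_of_not_differentiableAt hd]
      exact ⟨le_rfl, by positivity⟩
  have ht : Filter.Tendsto (fun B : ℝ => 4 * B / m) (nhdsWithin 0 (Set.Ioi 0)) (nhds 0) := by
    have : Continuous (fun B : ℝ => 4 * B / m) := by fun_prop
    have := this.tendsto 0
    simp only [mul_zero, zero_div] at this
    exact this.mono_left nhdsWithin_le_nhds
  refine tendsto_of_tendsto_of_tendsto_of_le_of_le' tendsto_const_nhds ht ?_ ?_
  · filter_upwards [self_mem_nhdsWithin] with B hB using (hb B hB).1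
  · filter_upwards [self_mem_nhdsWithin] with B hB using (hb B hB).2

theorem aux_deriv_zero (h : ℝ → ℝ)
    (m : ℝ) (hm : 0 < m) (hlo : ∀ B, h 0 ≤ h B) (hhi : ∀ B, h B ≤ h 0 + B^2/m) :
    HasDerivAt h 0 0 := by
  rw [hasDerivAt_iff_isLittleO_nhds_zero]
  have h1 : (fun x : ℝ => h (0 + x) - h 0 - x • (0:ℝ)) =O[nhds 0] (fun x : ℝ => x^2) := by
    apply Asymptotics.IsBigO.of_bound (1/m)
    filter_upwards with x
    have a := hlo x
    have b := hhi x
    simp only [zero_add, smul_zero, sub_zero, Real.norm_eq_abs]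
    rw [abs_of_nonneg (by linarith), abs_of_nonneg (by positivity)]
    have : 1 / m * x^2 = x^2/m := by ring
    linarith
  exact h1.trans_isLittleO (by simpa using Asymptotics.isLittleO_pow_pow (𝕜 := ℝ) one_lt_two)

theorem aux_L_le {β B : ℝ} {d : ℕ} (hβ0 : 0 < β)
    (hb : d * (1 - Real.exp (-2*β)) < 2) {t : ℝ} (ht : t ∈ Set.Icc (0:ℝ) 1) :
    LIsing β B d t ≤ HIsing β d (1/2) + B + B^2 / (2 - d * (1 - Real.exp (-2*β))) := by
  have h := aux_G_bound hβ0 hb ht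
  unfold LIsing
  have hm : 0 < 2 - d * (1 - Real.exp (-2*β)) := by linarith
  set m := 2 - d * (1 - Real.exp (-2*β))
  have : 2 * B * (t - 1/2) - m * (t - 1/2)^2 ≤ B^2 / m := by
    rw [le_div_iff₀ hm]
    nlinarith [sq_nonneg (m * (t - 1/2) - B)]
  linarith

/-- in the high-temperature regime `0 < β < atanh(1/(d−1))`, `H` is twice
differentiable on `(0,1)` with `H'' < 0`, `H'` is strictly decreasing with unique zero
`t = 1/2`, and `ψ(β,·)` is differentiable at `B = 0` with derivative `0`; moreover
`∂_B ψ(β,B) → 0` as `B ↓ 0`. -/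
theorem annealed_high_temperature (β : ℝ) (d : ℕ) (hd : 3 ≤ d)
    (hβ0 : 0 < β) (hβ : β < artanh (1/((d:ℝ)-1))) :
    (∀ t ∈ Set.Ioo (0:ℝ) 1,
        DifferentiableAt ℝ (HIsing β d) t ∧
        DifferentiableAt ℝ (deriv (HIsing β d)) t ∧
        deriv (deriv (HIsing β d)) t < 0) ∧
    StrictAntiOn (deriv (HIsing β d)) (Set.Ioo (0:ℝ) 1) ∧
    deriv (HIsing β d) (1/2) = 0 ∧
    (∀ t ∈ Set.Ioo (0:ℝ) 1, deriv (HIsing β d) t = 0 → t = 1/2) ∧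
    HasDerivAt (fun B => psiIsing β B d) 0 0 ∧
    Filter.Tendsto (fun B => deriv (fun B' => psiIsing β B' d) B)
      (nhdsWithin 0 (Set.Ioi 0)) (nhds 0) := by
  have hb := aux_c_bound hd hβ
  have hm : 0 < 2 - d * (1 - Real.exp (-2*β)) := by linarith
  have hanti : StrictAntiOn (deriv (HIsing β d)) (Set.Ioo (0:ℝ) 1) := by
    apply strictAntiOn_of_deriv_neg (convex_Ioo 0 1)
    · exact fun x hx => (aux_H_deriv2 hx).continuousAt.continuousWithinAt
    · rw [interior_Ioo]
      intro x hx
      have := aux_H2_bound (d := d) hβ0 hb hx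
      linarith
  have hbdd : ∀ B, BddAbove ((LIsing β B d) '' Set.Icc (0:ℝ) 1) := by
    intro B
    refine ⟨HIsing β d (1/2) + B + B^2 / (2 - d * (1 - Real.exp (-2*β))), ?_⟩
    rintro _ ⟨t, ht, rfl⟩
    exact aux_L_le hβ0 hb ht
  have hne : ∀ B, ((LIsing β B d) '' Set.Icc (0:ℝ) 1).Nonempty :=
    fun B => ⟨_, 0, by norm_num, rfl⟩
  have hup : ∀ B, psiIsing β B d ≤ β*(d:ℝ)/2 + HIsing β d (1/2)
      + B^2 / (2 - d * (1 - Real.exp (-2*β))) := by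
    intro B
    have : sSup ((LIsing β B d) '' Set.Icc (0:ℝ) 1) ≤
        HIsing β d (1/2) + B + B^2 / (2 - d * (1 - Real.exp (-2*β))) := by
      apply csSup_le (hne B)
      rintro _ ⟨t, ht, rfl⟩
      exact aux_L_le hβ0 hb ht
    unfold psiIsing
    linarith
  have hdn : ∀ B, β*(d:ℝ)/2 + HIsing β d (1/2) ≤ psiIsing β B d := by
    intro B
    have : LIsing β B d (1/2) ≤ _ :=
      le_csSup (hbdd B) ⟨1/2, by norm_num, rfl⟩
    unfold psiIsing
    unfold LIsing at this ⊢
    linarith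
  have h0 : psiIsing β 0 d = β*(d:ℝ)/2 + HIsing β d (1/2) := by
    apply le_antisymm _ (hdn 0)
    have := hup 0
    simpa using this
  have hlo : ∀ B, psiIsing β 0 d ≤ psiIsing β B d := fun B => h0 ▸ hdn B
  have hhi : ∀ B, psiIsing β B d ≤ psiIsing β 0 d
      + B^2 / (2 - d * (1 - Real.exp (-2*β))) := fun B => h0 ▸ hup B
  have hconv : ConvexOn ℝ Set.univ (fun B => psiIsing β B d) := by
    refine ⟨convex_univ, ?_⟩
    intro x _ y _ a b ha hb' hab
    have : sSup ((LIsing β (a * x + b * y) d) '' Set.Icc (0:ℝ) 1)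
        ≤ a * sSup ((LIsing β x d) '' Set.Icc (0:ℝ) 1)
          + b * sSup ((LIsing β y d) '' Set.Icc (0:ℝ) 1) := by
      apply csSup_le (hne _)
      rintro _ ⟨t, ht, rfl⟩
      have h1 := mul_le_mul_of_nonneg_left (le_csSup (hbdd x) ⟨t, ht, rfl⟩) ha
      have h2 := mul_le_mul_of_nonneg_left (le_csSup (hbdd y) ⟨t, ht, rfl⟩) hb'
      refine le_trans (le_of_eq ?_) (add_le_add h1 h2)
      unfold LIsing
      linear_combination (-HIsing β d t) * hab
    simp only [smul_eq_mul]
    unfold psiIsing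
    linear_combination this - β*(d:ℝ)/2 * hab
  have hz := aux_deriv_zero _ _ hm hlo hhi
  refine ⟨?_, hanti, aux_H_half β d, ?_, hz, aux_final _ hz hconv _ hm hlo hhi⟩
  · intro t ht
    refine ⟨(aux_H_deriv ht).differentiableAt, (aux_H_deriv2 ht).differentiableAt, ?_⟩
    have := aux_H2_bound (d := d) hβ0 hb ht
    linarith
  · intro t ht h
    exact hanti.injOn ht (by norm_num) (h.trans (aux_H_half β d).symm)
end

section
/- Let β ≥ 0, let d ≥ 3 be an integer, and let B > 0. Then the equation L′(t) = log((1−t)/t) − d·log f(β,1−t) + 2B = 0 has a unique solution t* in (1/2,1); moreover L''(t*) ≠ 0, and t* is the unique maximizer of L over [0,1]. -/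
open Filter MeasureTheory

/-! ### The reduced derivative in the coordinate `y = artanh (2t-1)` -/

noncomputable def KK (c B : ℝ) (d : ℕ) (y : ℝ) : ℝ :=
  ((d:ℝ) - 2) * y - d * Real.arsinh (c * Real.sinh y) + 2 * B

noncomputable def KK' (c : ℝ) (d : ℕ) (y : ℝ) : ℝ :=
  ((d:ℝ) - 2) - d * (c * Real.cosh y / Real.sqrt (1 + (c * Real.sinh y)^2))

lemma KK_hasDerivAt (c B : ℝ) (d : ℕ) (y : ℝ) : HasDerivAt (KK c B d) (KK' c d y) y := by
  have h1 : HasDerivAt (fun y => c * Real.sinh y) (c * Real.cosh y) y :=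
    (Real.hasDerivAt_sinh y).const_mul c
  have h2 := (Real.hasDerivAt_arsinh (c * Real.sinh y)).comp y h1
  have h3 := (((hasDerivAt_id y).const_mul ((d:ℝ) - 2)).sub (h2.const_mul (d:ℝ))).add_const (2*B)
  refine (h3.congr_deriv ?_)
  unfold KK'
  rw [div_eq_mul_inv]
  ring

lemma ratio_mono {c : ℝ} (hc : 0 < c) (hc1 : c ≤ 1) {y z : ℝ} (hy : 0 ≤ y) (hyz : y ≤ z) :
    c * Real.cosh y / Real.sqrt (1 + (c * Real.sinh y)^2)
      ≤ c * Real.cosh z / Real.sqrt (1 + (c * Real.sinh z)^2) := by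
  have hch : Real.cosh y ≤ Real.cosh z := by
    rw [Real.cosh_le_cosh, abs_of_nonneg hy, abs_of_nonneg (hy.trans hyz)]; exact hyz
  have p1 : 0 < 1 + (c * Real.sinh y)^2 := by positivity
  have p2 : 0 < 1 + (c * Real.sinh z)^2 := by positivity
  have q1 := Real.cosh_pos y
  have q2 := Real.cosh_pos z
  rw [div_le_div_iff₀ (Real.sqrt_pos.2 p1) (Real.sqrt_pos.2 p2)]
  refine (pow_le_pow_iff_left₀ (by positivity) (by positivity) two_ne_zero).1 ?_
  · rw [mul_pow (c * Real.cosh y), mul_pow (c * Real.cosh z), Real.sq_sqrt p1.le, Real.sq_sqrt p2.le]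
    have e1 := Real.cosh_sq y
    have e2 := Real.cosh_sq z
    have e3 : (Real.cosh y)^2 ≤ (Real.cosh z)^2 := by gcongr
    have s1 : (Real.sinh y)^2 = (Real.cosh y)^2 - 1 := by linarith
    have s2 : (Real.sinh z)^2 = (Real.cosh z)^2 - 1 := by linarith
    have hc2 : c^2 ≤ 1 := by nlinarith
    simp only [mul_pow, s1, s2]
    have : 0 ≤ c^2 * (1 - c^2) * ((Real.cosh z)^2 - (Real.cosh y)^2) := by
      apply mul_nonneg (mul_nonneg (by positivity) (by linarith)) (by linarith)
    nlinarith

lemma KK'_anti {c : ℝ} (hc : 0 < c) (hc1 : c ≤ 1) (d : ℕ) {y z : ℝ} (hy : 0 ≤ y) (hyz : y ≤ z) :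
    KK' c d z ≤ KK' c d y := by
  unfold KK'
  have := ratio_mono hc hc1 hy hyz
  gcongr

lemma KK_zero (c B : ℝ) (d : ℕ) : KK c B d 0 = 2 * B := by simp [KK]

lemma KK_cont (c B : ℝ) (d : ℕ) : Continuous (KK c B d) :=
  continuous_iff_continuousAt.2 fun y => (KK_hasDerivAt c B d y).continuousAt

lemma KK'_neg {c B : ℝ} (hc : 0 < c) (hc1 : c ≤ 1) (hB : 0 < B) (d : ℕ) {y : ℝ} (hy : 0 < y)
    (h : KK c B d y ≤ 0) {z : ℝ} (hz : y ≤ z) : KK' c d z < 0 := by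
  obtain ⟨ξ, hξ, he⟩ := exists_hasDerivAt_eq_slope (KK c B d) (KK' c d) hy
    (KK_cont c B d).continuousOn (fun x _ => KK_hasDerivAt c B d x)
  have h1 : KK' c d ξ < 0 := by
    rw [he, KK_zero]
    apply div_neg_of_neg_of_pos <;> linarith
  exact (KK'_anti hc hc1 d hξ.1.le (hξ.2.le.trans hz)).trans_lt h1

lemma KK_lt {c B : ℝ} (hc : 0 < c) (hc1 : c ≤ 1) (hB : 0 < B) (d : ℕ) {y : ℝ} (hy : 0 < y)
    (h : KK c B d y ≤ 0) {z : ℝ} (hz : y < z) : KK c B d z < KK c B d y := by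
  obtain ⟨ξ, hξ, he⟩ := exists_hasDerivAt_eq_slope (KK c B d) (KK' c d) hz
    (KK_cont c B d).continuousOn (fun x _ => KK_hasDerivAt c B d x)
  have h1 := KK'_neg hc hc1 hB d hy h hξ.1.le
  rw [he, div_lt_iff₀ (by linarith)] at h1
  linarith

lemma KK_exists_zero {β B : ℝ} (hβ : 0 ≤ β) (hB : 0 < B) (d : ℕ) :
    ∃ y, 0 < y ∧ KK (Real.exp (-2*β)) B d y = 0 := by
  set c := Real.exp (-2*β) with hcdef
  have hc : 0 < c := Real.exp_pos _
  have hc1 : c ≤ 1 := by rw [hcdef, Real.exp_le_one_iff]; linarith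
  have hdb : 0 ≤ (d:ℝ) * β := by positivity
  set y0 : ℝ := d * β + B + 1 with hy0
  have h0 : 0 < y0 := by positivity
  have key : y0 + -2*β ≤ Real.arsinh (c * Real.sinh y0) := by
    rw [← Real.exp_le_exp, Real.exp_arsinh, Real.exp_add, ← hcdef, ← Real.cosh_add_sinh]
    have : c * Real.cosh y0 ≤ Real.sqrt (1 + (c * Real.sinh y0)^2) := by
      apply Real.le_sqrt_of_sq_le
      rw [mul_pow, mul_pow, Real.cosh_sq]
      nlinarith
    linarith
  have hneg : KK c B d y0 ≤ 0 := by
    unfold KK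
    have : (d:ℝ) * (y0 + -2*β) ≤ d * Real.arsinh (c * Real.sinh y0) := by gcongr
    nlinarith
  have := intermediate_value_Icc' h0.le (KK_cont c B d).continuousOn
  obtain ⟨y, hy, he⟩ := this (show (0:ℝ) ∈ _ from ⟨hneg, by rw [KK_zero]; linarith⟩)
  refine ⟨y, lt_of_le_of_ne hy.1 ?_, he⟩
  rintro rfl
  rw [KK_zero] at he
  linarith

noncomputable def yy (t : ℝ) : ℝ := (1/2) * Real.log (t / (1-t))

lemma yy_hasDerivAt {t : ℝ} (h0 : 0 < t) (h1 : t < 1) :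
    HasDerivAt yy (1 / (2 * t * (1-t))) t := by
  have h2 : 0 < 1 - t := by linarith
  have a : HasDerivAt (fun t : ℝ => t / (1-t)) ((1 * (1-t) - t * (-1)) / (1-t)^2) t :=
    (hasDerivAt_id t).div ((hasDerivAt_id t).const_sub 1) h2.ne'
  have b := (a.log (div_pos h0 h2).ne').const_mul (1/2 : ℝ)
  refine b.congr_deriv ?_
  field_simp
  ring

lemma exp_yy {t : ℝ} (h0 : 0 < t) (h1 : t < 1) : (Real.exp (yy t))^2 = t / (1-t) := by
  have h2 : 0 < 1 - t := by linarith
  rw [← Real.exp_nat_mul, yy]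
  rw [show ((2:ℕ):ℝ) * (1/2 * Real.log (t/(1-t))) = Real.log (t/(1-t)) by push_cast; ring]
  exact Real.exp_log (div_pos h0 h2)

lemma yy_lt {s t : ℝ} (h0 : 0 < s) (hst : s < t) (h1 : t < 1) : yy s < yy t := by
  unfold yy
  have : s / (1-s) < t / (1-t) := by
    rw [div_lt_div_iff₀ (by linarith) (by linarith)]; nlinarith
  have := Real.log_lt_log (div_pos h0 (by linarith)) this
  linarith

lemma yy_half : yy (1/2) = 0 := by norm_num [yy]

lemma exists_yy {y : ℝ} (hy : 0 < y) : ∃ t, t ∈ Set.Ioo (1/2:ℝ) 1 ∧ yy t = y := by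
  have hE : 1 < Real.exp (2*y) := by rw [Real.one_lt_exp_iff]; linarith
  refine ⟨Real.exp (2*y) / (1 + Real.exp (2*y)), ⟨?_, ?_⟩, ?_⟩
  · rw [div_lt_div_iff₀ (by norm_num) (by linarith)]; linarith
  · rw [div_lt_one (by linarith)]; linarith
  · have : Real.exp (2*y) / (1 + Real.exp (2*y)) / (1 - Real.exp (2*y) / (1 + Real.exp (2*y)))
        = Real.exp (2*y) := by
      have : 1 + Real.exp (2*y) ≠ 0 := by positivity
      field_simp
      ring
    rw [yy, this, Real.log_exp]; ring

/-! ### Facts on `f` -/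

lemma f_num_pos {c x : ℝ} (hc : 0 < c) (h : -1 < x) (h1 : x ≤ 1) :
    0 < c * x + Real.sqrt (1 + (c^2-1) * x^2) := by
  rcases lt_or_ge 0 x with hx | hx
  · have : 0 < c * x := by positivity
    have := Real.sqrt_nonneg (1 + (c^2-1) * x^2)
    linarith
  · have : -(c*x) < Real.sqrt (1 + (c^2-1) * x^2) := by
      apply Real.lt_sqrt_of_sq_lt
      nlinarith
    linarith

lemma f_pos_s5 (β : ℝ) {t : ℝ} (h0 : 0 ≤ t) (h1 : t < 1) : 0 < fIsing β t := by
  unfold fIsing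
  exact div_pos (f_num_pos (Real.exp_pos _) (by linarith) (by linarith)) (by linarith)

lemma f_mul (β : ℝ) {t : ℝ} (h0 : 0 < t) (h1 : t < 1) : fIsing β t * fIsing β (1-t) = 1 := by
  unfold fIsing
  set c := Real.exp (-2*β)
  have e : (1 - 2*(1-t))^2 = (1-2*t)^2 := by ring
  rw [e]
  have hS : 0 ≤ 1 + (c^2-1) * (1-2*t)^2 := by nlinarith [sq_nonneg (c * (1-2*t))]
  have hS2 := Real.sq_sqrt hS
  set S := Real.sqrt (1 + (c^2-1) * (1-2*t)^2)
  have h2 : 1 - t ≠ 0 := by linarith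
  rw [div_mul_div_comm, div_eq_one_iff_eq]
  · nlinarith
  · have : 1 - (1-t) ≠ 0 := by linarith
    positivity

lemma logf_symm (β : ℝ) {t : ℝ} (h0 : 0 < t) (h1 : t < 1) :
    Real.log (fIsing β t) = - Real.log (fIsing β (1-t)) := by
  have := congrArg Real.log (f_mul β h0 h1)
  rw [Real.log_mul (f_pos_s5 β h0.le h1).ne' (f_pos_s5 β (by linarith) (by linarith)).ne',
    Real.log_one] at this
  linarith

lemma logf_contAt (β : ℝ) {t : ℝ} (h0 : 0 ≤ t) (h1 : t < 1) :
    ContinuousAt (fun s => Real.log (fIsing β s)) t := by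
  apply ContinuousAt.log _ (f_pos_s5 β h0 h1).ne'
  unfold fIsing
  apply ContinuousAt.div
  · fun_prop
  · fun_prop
  · have : 1 - t ≠ 0 := by linarith
    positivity

lemma logf_meas (β : ℝ) : Measurable (fun s => Real.log (fIsing β s)) := by
  unfold fIsing
  fun_prop

lemma logf_eq (β : ℝ) {t : ℝ} (h0 : 0 < t) (h1 : t < 1) :
    Real.log (fIsing β (1-t)) = Real.arsinh (Real.exp (-2*β) * Real.sinh (yy t)) - yy t := by
  have hf : fIsing β (1-t) = Real.exp (Real.arsinh (Real.exp (-2*β) * Real.sinh (yy t)) - yy t) := by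
    rw [Real.exp_sub, Real.exp_arsinh]
    unfold fIsing
    set c := Real.exp (-2*β)
    have hE := exp_yy h0 h1
    have h2 : 0 < 1 - t := by linarith
    rw [eq_div_iff h2.ne'] at hE
    have hsc := Real.cosh_add_sinh (yy t)
    have hcs := Real.cosh_sq (yy t)
    have hC := Real.cosh_pos (yy t)
    rw [← hsc] at hE ⊢
    have hS : 0 < Real.cosh (yy t) + Real.sinh (yy t) := by rw [hsc]; exact Real.exp_pos _
    generalize Real.cosh (yy t) = C at *
    generalize Real.sinh (yy t) = s at *
    have hx : s = (2*t-1) * C := by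
      have : (C - s) * (C + s) = 1 := by linarith
      have h3 : (C+s) * (1-t) = t * (C - s) := by
        linear_combination (C - s) * hE - (C + s) * (1 - t) * this
      linarith
    have hr : Real.sqrt (1 + (c*s)^2)
        = C * Real.sqrt (1 + (c^2-1) * (1-2*(1-t))^2) := by
      rw [show C * Real.sqrt (1 + (c^2-1) * (1-2*(1-t))^2)
        = Real.sqrt (C^2) * Real.sqrt (1 + (c^2-1) * (1-2*(1-t))^2) by rw [Real.sqrt_sq hC.le],
        ← Real.sqrt_mul (sq_nonneg _)]
      congr 1
      have : (C - s) * (C + s) = 1 := by linarith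
      subst hx
      linear_combination -hcs
    rw [hr]
    have : C + s = C * (2*t) := by rw [hx]; ring
    rw [this, div_eq_div_iff (by linarith) (by positivity)]
    rw [hx]; ring
  rw [hf, Real.log_exp]

noncomputable def LpIsing (β B : ℝ) (d : ℕ) (t : ℝ) : ℝ :=
  Real.log ((1-t)/t) - (d:ℝ) * Real.log (fIsing β (1-t)) + 2*B

lemma Lp_eq (β B : ℝ) (d : ℕ) {t : ℝ} (h0 : 0 < t) (h1 : t < 1) :
    LpIsing β B d t = KK (Real.exp (-2*β)) B d (yy t) := by
  have : Real.log ((1-t)/t) = - 2 * yy t := by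
    rw [yy, ← inv_div, Real.log_inv]; ring
  unfold LpIsing KK
  rw [logf_eq β h0 h1, this]
  ring

/-! ### `F` and `L` -/

noncomputable def Phi (β t : ℝ) : ℝ := ∫ s in (0:ℝ)..t, Real.log (fIsing β s)

lemma logf_int (β : ℝ) {t : ℝ} (h0 : 0 ≤ t) (h1 : t < 1) :
    IntervalIntegrable (fun s => Real.log (fIsing β s)) volume 0 t := by
  apply ContinuousOn.intervalIntegrable
  intro s hs
  rw [Set.uIcc_of_le h0] at hs
  exact (logf_contAt β hs.1 (hs.2.trans_lt h1)).continuousWithinAt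

lemma Phi_hasDerivAt (β : ℝ) {t : ℝ} (h0 : 0 < t) (h1 : t < 1) :
    HasDerivAt (Phi β) (-Real.log (fIsing β (1-t))) t := by
  rw [← logf_symm β h0 h1]
  exact intervalIntegral.integral_hasDerivAt_right (logf_int β h0.le h1)
    ((logf_meas β).stronglyMeasurable.stronglyMeasurableAtFilter) (logf_contAt β h0.le h1)

lemma Phi'_hasDerivAt (β : ℝ) {t : ℝ} (h0 : 0 < t) (h1 : t < 1) :
    HasDerivAt (fun t => Phi β (1-t)) (-Real.log (fIsing β (1-t))) t := by
  have a := Phi_hasDerivAt β (t := 1-t) (by linarith) (by linarith)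
  have b := a.comp t ((hasDerivAt_id t).const_sub 1)
  refine b.congr_deriv ?_
  rw [logf_symm β (t := 1-t) (by linarith) (by linarith)]
  ring_nf

lemma F_hasDerivAt (β : ℝ) {t : ℝ} (h0 : 0 < t) (h1 : t < 1) :
    HasDerivAt (FIsing β) (-Real.log (fIsing β (1-t))) t := by
  have e1 : ∀ s : ℝ, s ≤ 1/2 → FIsing β s = Phi β s := fun s hs => by
    unfold FIsing Phi; rw [min_eq_left (by linarith)]
  have e2 : ∀ s : ℝ, 1/2 ≤ s → FIsing β s = Phi β (1-s) := fun s hs => by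
    unfold FIsing Phi; rw [min_eq_right (by linarith)]
  rcases lt_trichotomy t (1/2) with h | h | h
  · refine (Phi_hasDerivAt β h0 h1).congr_of_eventuallyEq ?_
    filter_upwards [Iio_mem_nhds h] with s hs using e1 s (le_of_lt hs)
  · have a : HasDerivWithinAt (FIsing β) (-Real.log (fIsing β (1-t))) (Set.Iic t) t :=
      (Phi_hasDerivAt β h0 h1).hasDerivWithinAt.congr
        (fun s hs => e1 s (h ▸ hs)) (e1 t h.le)
    have b : HasDerivWithinAt (FIsing β) (-Real.log (fIsing β (1-t))) (Set.Ici t) t :=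
      (Phi'_hasDerivAt β h0 h1).hasDerivWithinAt.congr
        (fun s hs => e2 s (h ▸ hs)) (e2 t h.ge)
    have := a.union b
    rwa [Set.Iic_union_Ici, hasDerivWithinAt_univ] at this
  · refine (Phi'_hasDerivAt β h0 h1).congr_of_eventuallyEq ?_
    filter_upwards [Ioi_mem_nhds h] with s hs using e2 s (le_of_lt hs)

lemma I_hasDerivAt {t : ℝ} (h0 : 0 < t) (h1 : t < 1) :
    HasDerivAt IIsing (Real.log ((1-t)/t)) t := by
  have h2 : 0 < 1 - t := by linarith
  have a := ((hasDerivAt_id t).sub_const 1).mul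
    (((hasDerivAt_id t).const_sub 1).log h2.ne')
  have b := (hasDerivAt_id t).mul (Real.hasDerivAt_log h0.ne')
  refine (a.sub b).congr_deriv ?_
  rw [Real.log_div h2.ne' h0.ne']
  simp only [id]
  field_simp
  ring

lemma L_hasDerivAt (β B : ℝ) (d : ℕ) {t : ℝ} (h0 : 0 < t) (h1 : t < 1) :
    HasDerivAt (LIsing β B d) (LpIsing β B d t) t := by
  have := ((I_hasDerivAt h0 h1).add ((F_hasDerivAt β h0 h1).const_mul (d:ℝ))).add
    ((hasDerivAt_id t).const_mul (2*B))
  refine this.congr_deriv ?_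
  unfold LpIsing
  ring

lemma I_cont : Continuous IIsing := by
  have a := Real.continuous_mul_log
  have b : Continuous (fun t : ℝ => (1-t) * Real.log (1-t)) :=
    a.comp (continuous_const.sub continuous_id)
  have : IIsing = fun t => -((1-t) * Real.log (1-t)) - t * Real.log t := by
    funext t; unfold IIsing; ring
  rw [this]
  exact b.neg.sub a

lemma L_cont (β B : ℝ) (d : ℕ) : ContinuousOn (LIsing β B d) (Set.Icc 0 1) := by
  have hP : ContinuousOn (Phi β) (Set.Icc 0 (1/2)) := by
    have := intervalIntegral.continuousOn_primitive_interval'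
      (logf_int β (t := 1/2) (by norm_num) (by norm_num)) (Set.left_mem_uIcc)
    rwa [Set.uIcc_of_le (by norm_num)] at this
  have hF : ContinuousOn (FIsing β) (Set.Icc 0 1) := by
    refine hP.comp (f := fun t : ℝ => min t (1-t)) (by fun_prop) ?_
    intro t ht
    refine ⟨le_min ht.1 (by linarith [ht.2]), ?_⟩
    rcases le_total t (1/2) with h | h
    · exact (min_le_left _ _).trans h
    · exact (min_le_right _ _).trans (by linarith)
  have hI := I_cont.continuousOn (s := Set.Icc (0:ℝ) 1)
  unfold LIsing HIsing
  fun_prop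

lemma L_symm (β B : ℝ) (d : ℕ) (t : ℝ) :
    LIsing β B d (1-t) = LIsing β B d t + 2*B*(1-2*t) := by
  unfold LIsing HIsing IIsing FIsing
  rw [show 1 - (1-t) = t by ring, min_comm (1-t) t]
  ring

/-- for `β ≥ 0`, `d ≥ 3`, `B > 0`, the derivative of `L` is given by
`L'(t) = log((1−t)/t) − d log f(β,1−t) + 2B`; the equation `L'(t) = 0` has a unique
solution `t*` in `(1/2,1)`, `L''(t*) ≠ 0`, and `t*` is the unique maximizer of `L`
over `[0,1]`. -/
theorem annealed_L_unique_max (β B : ℝ) (hβ : 0 ≤ β) (d : ℕ) (hd : 3 ≤ d) (hB : 0 < B) :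
    (∀ t ∈ Set.Ioo (0:ℝ) 1, deriv (LIsing β B d) t
        = Real.log ((1-t)/t) - (d:ℝ) * Real.log (fIsing β (1-t)) + 2*B) ∧
    ∃ tstar : ℝ, tstar ∈ Set.Ioo (1/2 : ℝ) 1 ∧
      (Real.log ((1-tstar)/tstar) - (d:ℝ) * Real.log (fIsing β (1-tstar)) + 2*B = 0) ∧
      (∀ t ∈ Set.Ioo (1/2 : ℝ) 1,
        Real.log ((1-t)/t) - (d:ℝ) * Real.log (fIsing β (1-t)) + 2*B = 0 → t = tstar) ∧
      deriv (deriv (LIsing β B d)) tstar ≠ 0 ∧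
      (∀ t ∈ Set.Icc (0:ℝ) 1, t ≠ tstar → LIsing β B d t < LIsing β B d tstar) := by
  have hc : 0 < Real.exp (-2*β) := Real.exp_pos _
  have hc1 : Real.exp (-2*β) ≤ 1 := by rw [Real.exp_le_one_iff]; linarith
  refine ⟨fun t ht => (L_hasDerivAt β B d ht.1 ht.2).deriv, ?_⟩
  obtain ⟨y, hy, hKy⟩ := KK_exists_zero hβ hB d
  obtain ⟨ts, hts, hyt⟩ := exists_yy hy
  have hts0 : 0 < ts := by linarith [hts.1]
  have hLpt : ∀ t, 0 < t → t < 1 → LpIsing β B d t = KK (Real.exp (-2*β)) B d (yy t) :=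
    fun t h0 h1 => Lp_eq β B d h0 h1
  have hneg : ∀ t, ts < t → t < 1 → LpIsing β B d t < 0 := by
    intro t h0 h1
    rw [hLpt t (hts0.trans h0) h1, ← hKy]
    apply KK_lt hc hc1 hB d hy hKy.le
    rw [← hyt]
    exact yy_lt hts0 h0 h1
  have hpos : ∀ t, 1/2 < t → t < ts → 0 < LpIsing β B d t := by
    intro t h0 h1
    have ht1 := h1.trans hts.2
    rw [hLpt t (by linarith) ht1]
    by_contra! hle
    have hy0 : 0 < yy t := by rw [← yy_half]; exact yy_lt (by norm_num) h0 ht1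
    have hlt : yy t < y := by rw [← hyt]; exact yy_lt (by linarith) h1 hts.2
    have := KK_lt hc hc1 hB d hy0 hle hlt
    linarith
  have hmono : StrictMonoOn (LIsing β B d) (Set.Icc (1/2) ts) := by
    apply strictMonoOn_of_deriv_pos (convex_Icc _ _)
      ((L_cont β B d).mono (Set.Icc_subset_Icc (by norm_num) hts.2.le))
    intro t ht
    rw [interior_Icc] at ht
    rw [(L_hasDerivAt β B d (by linarith [ht.1]) (ht.2.trans hts.2)).deriv]
    exact hpos t ht.1 ht.2
  have hanti : StrictAntiOn (LIsing β B d) (Set.Icc ts 1) := by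
    apply strictAntiOn_of_deriv_neg (convex_Icc _ _)
      ((L_cont β B d).mono (Set.Icc_subset_Icc hts0.le le_rfl))
    intro t ht
    rw [interior_Icc] at ht
    rw [(L_hasDerivAt β B d (hts0.trans ht.1) ht.2).deriv]
    exact hneg t ht.1 ht.2
  have hmax : ∀ t, 1/2 ≤ t → t ≤ 1 → t ≠ ts → LIsing β B d t < LIsing β B d ts := by
    intro t h0 h1 hne
    rcases lt_or_gt_of_ne hne with h | h
    · exact hmono ⟨h0, h.le⟩ ⟨hts.1.le, le_rfl⟩ h
    · exact hanti ⟨le_rfl, hts.2.le⟩ ⟨h.le, h1⟩ h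
  refine ⟨ts, hts, ?_, ?_, ?_, ?_⟩
  · change LpIsing β B d ts = 0
    rw [hLpt ts hts0 hts.2, hyt, hKy]
  · intro t ht h
    change LpIsing β B d t = 0 at h
    by_contra hne
    rcases lt_or_gt_of_ne hne with h' | h'
    · exact (hpos t ht.1 h').ne' h
    · exact (hneg t h' ht.2).ne h
  · have hev : deriv (LIsing β B d) =ᶠ[nhds ts] fun t => KK (Real.exp (-2*β)) B d (yy t) := by
      filter_upwards [Ioo_mem_nhds hts0 hts.2] with t ht
      rw [(L_hasDerivAt β B d ht.1 ht.2).deriv, hLpt t ht.1 ht.2]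
    rw [hev.deriv_eq]
    have h1 : HasDerivAt (fun t => KK (Real.exp (-2*β)) B d (yy t))
        (KK' (Real.exp (-2*β)) d (yy ts) * (1 / (2 * ts * (1-ts)))) ts :=
      (KK_hasDerivAt (Real.exp (-2*β)) B d (yy ts)).comp ts (yy_hasDerivAt hts0 hts.2)
    rw [h1.deriv, hyt]
    have h2 : 0 < 1 - ts := by linarith [hts.2]
    exact mul_ne_zero (KK'_neg hc hc1 hB d hy hKy.le le_rfl).ne (by positivity)
  · intro t ht hne
    rcases lt_or_ge t (1/2) with h | h
    · have h1 := L_symm β B d t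
      have h2 : 0 < 2*B*(1-2*t) := mul_pos (by linarith) (by linarith)
      have h3 : LIsing β B d (1-t) ≤ LIsing β B d ts := by
        by_cases he : 1 - t = ts
        · rw [he]
        · exact (hmax (1-t) (by linarith) (by linarith [ht.1]) he).le
      linarith
    · exact hmax t h ht.2 hne
end
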